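/- For every l ≥ 1, the ice quiver with potential (Diamond_l, W_l) is rigid: every potential on the quiver Diamond_l is cyclically equivalent to an element of the Jacobian ideal ∂W_l. -/

import Mathlib

noncomputable section
open scoped Classical

/-! ## The diamond quiver `Diamond_l`, its potential `W_l`, and the completed path algebra
(realized as the space of coefficient functions on paths). -/

/-- Ambient vertex labels: `(true, j, k)` is the positive label `(i;j,k)` and `(false, j, k)`
the negative label `(j,k;i)`, where `i = j + k`; horizontal labels (`j = 0` or `k = 0`) are
identified, with canonical sign `true`. -/
abbrev VT : Type := Bool × ℕ × ℕ

/-- Canonical representative of a label. -/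
def canon (v : VT) : VT := if v.2.1 = 0 ∨ v.2.2 = 0 then (true, v.2.1, v.2.2) else v

/-- The vertex set `Diamond_l^0`. -/
def IsVert (l : ℕ) (v : VT) : Prop := canon v = v ∧ 1 ≤ v.2.1 + v.2.2 ∧ v.2.1 + v.2.2 ≤ l

/-- Arrow types of `Diamond_l`. -/
inductive ArrT | A | B | C
deriving DecidableEq

instance : Fintype ArrT := ⟨⟨{ArrT.A, ArrT.B, ArrT.C}, by decide⟩, fun x => by cases x <;> decide⟩

/-- An arrow of `Diamond_l`: its type together with its raw (signed) source label.
Type `A`: `±(i;j,k) → ±(i−1;j−1,k)`; type `B`: `±(i;j,k) → ±(i+1;j,k+1)`;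
type `C`: `±(i;j,k) → ±(i;j+1,k−1)`.  The two type-`C` arrows `(1;0,1) → (1;1,0)` are
realized as the two raw signs. -/
abbrev Arr : Type := ArrT × VT

/-- The raw target of an arrow. -/
def rawTgt : Arr → VT
  | (ArrT.A, s, j, k) => (s, j - 1, k)
  | (ArrT.B, s, j, k) => (s, j, k + 1)
  | (ArrT.C, s, j, k) => (s, j + 1, k - 1)

/-- Source vertex of an arrow. -/
def asrc (a : Arr) : VT := canon a.2

/-- Target vertex of an arrow. -/
def atgt (a : Arr) : VT := canon (rawTgt a)

/-- Whether an arrow belongs to `Diamond_l`.  Raw sign `false` is excluded when both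
endpoints are horizontal, except for the doubled type-`C` arrows `(1;0,1) → (1;1,0)`. -/
def ValidArr (l : ℕ) : Arr → Prop
  | (ArrT.A, s, j, k) => 1 ≤ j ∧ 2 ≤ j + k ∧ j + k ≤ l ∧ (k = 0 → s = true)
  | (ArrT.B, s, j, k) => 1 ≤ j + k ∧ j + k + 1 ≤ l ∧ (j = 0 → s = true)
  | (ArrT.C, _, j, k) => 1 ≤ k ∧ j + k ≤ l

/-- Both endpoints of the arrow are horizontal vertices (i.e. the arrow lies on the axis). -/
def bothHoriz (a : Arr) : Prop :=
  (a.2.2.1 = 0 ∨ a.2.2.2 = 0) ∧ ((rawTgt a).2.1 = 0 ∨ (rawTgt a).2.2 = 0)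

/-- The arrow is nonnegative (lies on or above the axis). -/
def nonnegA (a : Arr) : Prop := a.2.1 = true

/-- The arrow is nonpositive (lies on or below the axis). -/
def nonposA (a : Arr) : Prop := a.2.1 = false ∨ (bothHoriz a ∧ a.1 ≠ ArrT.C)

/-- A path datum: a starting vertex together with a list of arrows. -/
abbrev PathD : Type := VT × List Arr

/-- Wellformedness of a list of arrows starting at `v`. -/
def WFfrom (l : ℕ) : VT → List Arr → Prop
  | v, [] => IsVert l v
  | v, a :: L => ValidArr l a ∧ asrc a = v ∧ WFfrom l (atgt a) L

/-- Wellformedness of a path datum. -/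
def WFpath (l : ℕ) (p : PathD) : Prop := WFfrom l p.1 p.2

/-- The end vertex of a path. -/
def endV : VT → List Arr → VT
  | v, [] => v
  | _, a :: L => endV (atgt a) L

/-- An element of the completed path algebra of `Diamond_l` is a coefficient function on
paths (supported on wellformed paths). -/
abbrev CPA : Type := PathD → ℂ

/-- The coefficient function of the potential
`W_l = (a₊b₊c₊ − a₊c₊b₊) + (a₋b₋c₋ − a₋c₋b₋)`. -/
def Wpot (l : ℕ) : CPA := fun p =>
  match p with
  | (v, [x, y, z]) =>
    (if WFfrom l v [x, y, z] ∧ endV v [x, y, z] = v ∧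
        x.1 = ArrT.A ∧ y.1 = ArrT.B ∧ z.1 = ArrT.C ∧
        nonnegA x ∧ nonnegA y ∧ nonnegA z then 1 else 0)
    - (if WFfrom l v [x, y, z] ∧ endV v [x, y, z] = v ∧
        x.1 = ArrT.A ∧ y.1 = ArrT.C ∧ z.1 = ArrT.B ∧
        nonnegA x ∧ nonnegA y ∧ nonnegA z then 1 else 0)
    + (if WFfrom l v [x, y, z] ∧ endV v [x, y, z] = v ∧
        x.1 = ArrT.A ∧ y.1 = ArrT.B ∧ z.1 = ArrT.C ∧
        nonposA x ∧ nonposA y ∧ nonposA z then 1 else 0)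
    - (if WFfrom l v [x, y, z] ∧ endV v [x, y, z] = v ∧
        x.1 = ArrT.A ∧ y.1 = ArrT.C ∧ z.1 = ArrT.B ∧
        nonposA x ∧ nonposA y ∧ nonposA z then 1 else 0)
  | _ => 0

/-- The `r`-th rotation of a cyclic path. -/
def rotP (r : ℕ) (p : PathD) : PathD := (endV p.1 (p.2.take r), p.2.drop r ++ p.2.take r)

/-- The cyclic derivative `∂_a W` of a potential `W` with respect to an arrow `a`:
the coefficient of a path `p` (from `tgt a` to `src a`) is the sum of the coefficients of
`W` at all rotations of the cycle `a · p`. -/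
def cycDeriv (W : CPA) (a : Arr) : CPA := fun p =>
  if p.1 = atgt a ∧ endV p.1 p.2 = asrc a then
    ∑ r ∈ Finset.range (p.2.length + 1), W (rotP r (asrc a, a :: p.2))
  else 0

/-- The basis element of the path algebra attached to a path. -/
def deltaP (p : PathD) : CPA := fun q => if q = p then 1 else 0

/-- Left multiplication of a coefficient function by (the basis element of) a path. -/
def lmul (p : PathD) (f : CPA) : CPA := fun q =>
  if q.1 = p.1 ∧ p.2 <+: q.2 then f (endV p.1 p.2, q.2.drop p.2.length) else 0

/-- Right multiplication of a coefficient function by (the basis element of) a path. -/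
def rmul (f : CPA) (p : PathD) : CPA := fun q =>
  if p.2 <:+ q.2 ∧ endV q.1 (q.2.take (q.2.length - p.2.length)) = p.1 then
    f (q.1, q.2.take (q.2.length - p.2.length))
  else 0

/-- Generators `p · (∂_a W_l) · q` of the Jacobian ideal. -/
def jacGens (l : ℕ) : Set CPA :=
  {h | ∃ (a : Arr) (p q : PathD), ValidArr l a ∧ WFpath l p ∧ WFpath l q ∧
    endV p.1 p.2 = atgt a ∧ q.1 = asrc a ∧ h = lmul p (rmul (cycDeriv (Wpot l) a) q)}

/-- The closure (in the adic topology of the completed path algebra) of the span of a set: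
`f` lies in it iff for every `n` it agrees with an element of the span on all paths of
length `≤ n`. -/
def closSpan (S : Set CPA) : Set CPA :=
  {f | ∀ n : ℕ, ∃ g ∈ Submodule.span ℂ S, ∀ p : PathD, p.2.length ≤ n → f p = g p}

/-- Generators `c − rot(c)` of cyclic equivalence. -/
def cycGens (l : ℕ) : Set CPA :=
  {h | ∃ (p : PathD) (r : ℕ), WFpath l p ∧ endV p.1 p.2 = p.1 ∧ p.2 ≠ [] ∧
    h = deltaP p - deltaP (rotP r p)}

/-- A potential on `Diamond_l`: a (possibly infinite) linear combination of oriented cycles,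
i.e. a coefficient function supported on wellformed cycles of positive length. -/
def IsPotential (l : ℕ) (U : CPA) : Prop :=
  ∀ p, U p ≠ 0 → WFpath l p ∧ endV p.1 p.2 = p.1 ∧ p.2 ≠ []

/-! ### Arrows and cycles of the diamond quiver -/

lemma canon_snd (v : VT) : (canon v).2 = v.2 := by
  unfold canon; split <;> rfl

lemma asrc_snd (a : Arr) : (asrc a).2 = a.2.2 := canon_snd _

lemma atgt_snd (a : Arr) : (atgt a).2 = (rawTgt a).2 := canon_snd _

lemma canon_canon (v : VT) : canon (canon v) = canon v := by
  unfold canon; grind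

lemma ValidArr.isVert_asrc {l : ℕ} {a : Arr} (h : ValidArr l a) : IsVert l (asrc a) := by
  refine ⟨canon_canon _, ?_, ?_⟩ <;> rw [asrc_snd] <;> obtain ⟨_ | _ | _, s, j, k⟩ := a <;>
    simp only [ValidArr] at h ⊢ <;> omega

/-- The arrow lies in the closed half of the diamond with the given sign. -/
def Signed : Bool → Arr → Prop
  | true => nonnegA
  | false => nonposA

/-- The arrow of type `T` starting at `(j, k)` in the closed half of sign `s`. -/
def signedArr (T : ArrT) (s : Bool) (v : ℕ × ℕ) : Arr :=
  match T with
  | ArrT.A => (ArrT.A, if v.2 = 0 then true else s, v)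
  | ArrT.B => (ArrT.B, if v.1 = 0 then true else s, v)
  | ArrT.C => (ArrT.C, s, v)

lemma signed_iff {l : ℕ} {a : Arr} (h : ValidArr l a) (s : Bool) :
    Signed s a ↔ a = signedArr a.1 s a.2.2 := by
  obtain ⟨_ | _ | _, t, j, k⟩ := a <;> cases s <;> cases t <;>
    simp_all [Signed, signedArr, nonnegA, nonposA, bothHoriz, rawTgt, ValidArr]; omega

/-- The arrow type following a given one in the cyclic order `A, B, C`. -/
def ArrT.next : ArrT → ArrT
  | A => B
  | B => C
  | C => A

/-- `a`, `u`, `w` form an oriented triangle based at the target `v` of `a`. -/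
def Triangle (l : ℕ) (a u w : Arr) (v : VT) : Prop :=
  ValidArr l a ∧ ValidArr l u ∧ ValidArr l w ∧
    v = atgt a ∧ asrc u = atgt a ∧ asrc w = atgt u ∧ asrc a = atgt w

lemma Wpot_three (l : ℕ) (v : VT) (x y z : Arr) : Wpot l (v, [x, y, z]) =
    (if Triangle l z x y v ∧ x.1 = ArrT.A ∧ y.1 = ArrT.B ∧ z.1 = ArrT.C ∧
      Signed true x ∧ Signed true y ∧ Signed true z then 1 else 0)
    - (if Triangle l z x y v ∧ x.1 = ArrT.A ∧ y.1 = ArrT.C ∧ z.1 = ArrT.B ∧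
      Signed true x ∧ Signed true y ∧ Signed true z then 1 else 0)
    + (if Triangle l z x y v ∧ x.1 = ArrT.A ∧ y.1 = ArrT.B ∧ z.1 = ArrT.C ∧
      Signed false x ∧ Signed false y ∧ Signed false z then 1 else 0)
    - (if Triangle l z x y v ∧ x.1 = ArrT.A ∧ y.1 = ArrT.C ∧ z.1 = ArrT.B ∧
      Signed false x ∧ Signed false y ∧ Signed false z then 1 else 0) := by
  have key : (WFfrom l v [x, y, z] ∧ endV v [x, y, z] = v) ↔ Triangle l z x y v := by
    simp only [WFfrom, endV, Triangle]
    constructor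
    · rintro ⟨⟨hx, h1, hy, h2, hz, h3, h4⟩, h5⟩
      exact ⟨hz, hx, hy, h5.symm, h1.trans h5.symm, h2, h3⟩
    · rintro ⟨hz, hx, hy, rfl, h1, h2, h3⟩
      exact ⟨⟨hx, h1, hy, h2, hz, h3, h1 ▸ hx.isVert_asrc⟩, rfl⟩
  simp only [Wpot, Signed, ← key, and_assoc]

lemma cycDeriv_two {l : ℕ} {a : Arr} {s : Bool} (ha : ∀ t, Signed t a ↔ t = s)
    (v : VT) (u w : Arr) : cycDeriv (Wpot l) a (v, [u, w]) =
    (if Triangle l a u w v ∧ u.1 = a.1.next ∧ w.1 = a.1.next.next ∧ Signed s u ∧ Signed s w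
      then 1 else 0)
    - (if Triangle l a u w v ∧ u.1 = a.1.next.next ∧ w.1 = a.1.next ∧ Signed s u ∧ Signed s w
      then 1 else 0) := by
  have e1 : Triangle l a u w (atgt a) ↔ Triangle l u w a (atgt u) := by
    simp only [Triangle]; tauto
  have e2 : Triangle l a u w (atgt a) ↔ Triangle l w a u (asrc a) := by
    simp only [Triangle]; tauto
  by_cases hv : v = atgt a ∧ atgt w = asrc a
  · obtain ⟨rfl, hw⟩ := hv
    simp only [cycDeriv, endV, hw, and_self, if_true, List.length_cons, List.length_nil,
      Finset.sum_range_succ, Finset.sum_range_zero, rotP, List.take, List.drop,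
      List.cons_append, List.nil_append, Wpot_three, ha, ← e1, ← e2]
    obtain ⟨T, a⟩ := a
    cases T <;> cases s <;> simp [ArrT.next] <;> grind
  · rw [if_neg, if_neg]
    · simp only [cycDeriv, endV, if_neg hv, sub_zero]
    · exact fun h => hv ⟨h.1.2.2.2.1, h.1.2.2.2.2.2.2.symm⟩
    · exact fun h => hv ⟨h.1.2.2.2.1, h.1.2.2.2.2.2.2.symm⟩

lemma cycDeriv_ne_two (l : ℕ) (a : Arr) (v : VT) (L : List Arr) (hL : L.length ≠ 2) :
    cycDeriv (Wpot l) a (v, L) = 0 := by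
  unfold cycDeriv
  split
  · refine Finset.sum_eq_zero fun r hr => ?_
    have hlen : ((a :: L).drop r ++ (a :: L).take r).length ≠ 3 := by
      simp only [List.length_append, List.length_drop, List.length_take, List.length_cons]
      simp only [Finset.mem_range] at hr
      omega
    simp only [rotP]
    generalize (a :: L).drop r ++ (a :: L).take r = M at hlen
    match M, hlen with
    | [], _ => rfl
    | [_], _ => rfl
    | [_, _], _ => rfl
    | [_, _, _], h => exact absurd rfl h
    | _ :: _ :: _ :: _ :: _, _ => rfl
  · rfl

lemma Triangle.eq_signedArr {l : ℕ} {a u w : Arr} {v : VT} {s : Bool} (h : Triangle l a u w v)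
    (hu : Signed s u) (hw : Signed s w) :
    u = signedArr u.1 s (rawTgt a).2 ∧ w = signedArr w.1 s (rawTgt u).2 := by
  obtain ⟨-, h1, h2, -, h3, h4, -⟩ := h
  rw [signed_iff h1] at hu
  rw [signed_iff h2] at hw
  have h3' := congrArg Prod.snd h3
  have h4' := congrArg Prod.snd h4
  rw [asrc_snd, atgt_snd] at h3' h4'
  rw [← h3', ← h4']
  exact ⟨hu, hw⟩

lemma signed_signedArr {l : ℕ} {T : ArrT} {s : Bool} {v : ℕ × ℕ}
    (h : ValidArr l (signedArr T s v)) : Signed s (signedArr T s v) := by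
  rw [signed_iff h]; cases T <;> rfl

lemma signedArr_fst (T : ArrT) (s : Bool) (v : ℕ × ℕ) : (signedArr T s v).1 = T := by
  cases T <;> rfl

/-- The coefficient function of the path `x y` if it closes up to a triangle with `a`, and zero
otherwise. -/
def trianglePath (l : ℕ) (a x y : Arr) : CPA :=
  if Triangle l a x y (atgt a) then deltaP (atgt a, [x, y]) else 0

lemma ite_triangle_eq (l : ℕ) (a : Arr) (s : Bool) (T T' : ArrT) (v : VT) (u w : Arr) :
    (if Triangle l a u w v ∧ u.1 = T ∧ w.1 = T' ∧ Signed s u ∧ Signed s w then (1 : ℂ) else 0) =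
      trianglePath l a (signedArr T s (rawTgt a).2)
        (signedArr T' s (rawTgt (signedArr T s (rawTgt a).2)).2) (v, [u, w]) := by
  by_cases h : Triangle l a u w v ∧ u.1 = T ∧ w.1 = T' ∧ Signed s u ∧ Signed s w
  · rw [if_pos h]
    obtain ⟨h, rfl, rfl, hu, hw⟩ := h
    obtain ⟨e1, e2⟩ := h.eq_signedArr hu hw
    rw [← e1, ← e2]
    obtain rfl := h.2.2.2.1
    simp [trianglePath, h, deltaP]
  · rw [if_neg h]
    unfold trianglePath
    split_ifs with h'
    · rw [deltaP, if_neg]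
      intro e
      simp only [Prod.mk.injEq, List.cons.injEq, and_true] at e
      obtain ⟨rfl, rfl, rfl⟩ := e
      exact h ⟨h', signedArr_fst _ _ _, signedArr_fst _ _ _, signed_signedArr h'.2.1,
        signed_signedArr h'.2.2.1⟩
    · rfl

lemma trianglePath_ne_two (l : ℕ) (a x y : Arr) (v : VT) (L : List Arr) (hL : L.length ≠ 2) :
    trianglePath l a x y (v, L) = 0 := by
  unfold trianglePath deltaP
  split_ifs
  · exact if_neg fun e => hL (by rw [Prod.mk.injEq] at e; rw [e.2]; rfl)
  · rfl

lemma cycDeriv_eq {l : ℕ} {a : Arr} {s : Bool} (ha : ∀ t, Signed t a ↔ t = s) :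
    cycDeriv (Wpot l) a =
      trianglePath l a (signedArr a.1.next s (rawTgt a).2)
        (signedArr a.1.next.next s (rawTgt (signedArr a.1.next s (rawTgt a).2)).2) -
      trianglePath l a (signedArr a.1.next.next s (rawTgt a).2)
        (signedArr a.1.next s (rawTgt (signedArr a.1.next.next s (rawTgt a).2)).2) := by
  funext ⟨v, L⟩
  rw [Pi.sub_apply]
  by_cases hL : L.length = 2
  · obtain ⟨u, w, rfl⟩ := List.length_eq_two.1 hL
    rw [cycDeriv_two ha, ite_triangle_eq, ite_triangle_eq]
  · rw [cycDeriv_ne_two l a v L hL, trianglePath_ne_two _ _ _ _ _ _ hL,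
      trianglePath_ne_two _ _ _ _ _ _ hL, sub_zero]

/-- Each side of a triangle relation determines the other one up to sign. -/
lemma exists_cycDeriv_eq_smul {l : ℕ} {a x y : Arr} {s : Bool} {v : VT}
    (ha : ∀ t, Signed t a ↔ t = s) (h : Triangle l a x y v) (hx : Signed s x) (hy : Signed s y)
    (hT : x.1 = a.1.next ∧ y.1 = a.1.next.next ∨ x.1 = a.1.next.next ∧ y.1 = a.1.next) :
    ∃ ε : ℂ, ε ≠ 0 ∧ cycDeriv (Wpot l) a = ε • (deltaP (v, [x, y]) -
      trianglePath l a (signedArr y.1 s (rawTgt a).2)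
        (signedArr x.1 s (rawTgt (signedArr y.1 s (rawTgt a).2)).2)) := by
  obtain ⟨e1, e2⟩ := h.eq_signedArr hx hy
  have e3 : trianglePath l a (signedArr x.1 s (rawTgt a).2)
      (signedArr y.1 s (rawTgt (signedArr x.1 s (rawTgt a).2)).2) = deltaP (v, [x, y]) := by
    rw [← e1, ← e2]
    obtain rfl := h.2.2.2.1
    rw [trianglePath, if_pos h]
  rw [← e3]
  rcases hT with ⟨h1, h2⟩ | ⟨h1, h2⟩
  · exact ⟨1, one_ne_zero, by rw [cycDeriv_eq ha, one_smul, h1, h2]⟩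
  · exact ⟨-1, by norm_num, by rw [cycDeriv_eq ha, h1, h2, neg_smul, one_smul, neg_sub]⟩

/-- Consecutive arrows that can be rewritten, modulo the Jacobian ideal, into a path passing
through vertices of smaller total level. -/
def Reducible (x y : Arr) : Prop :=
  (x.1 = ArrT.B ∧ y.1 = ArrT.A) ∨ (x.1 = ArrT.C ∧ y.1 = ArrT.A ∧ 1 ≤ x.2.2.1) ∨
    (x.1 = ArrT.B ∧ y.1 = ArrT.C ∧ 1 ≤ x.2.2.2)

/-- The total level of the sources of a list of arrows. -/
def totalLevel (L : List Arr) : ℕ := (L.map fun a => a.2.2.1 + a.2.2.2).sum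

lemma Reducible.exists_triangle {l : ℕ} {x y : Arr} (h : Reducible x y) (hx : ValidArr l x)
    (hy : ValidArr l y) (hxy : asrc y = atgt x) :
    ∃ (a : Arr) (s : Bool), (∀ t, Signed t a ↔ t = s) ∧ Triangle l a x y (asrc x) ∧ Signed s x ∧
      Signed s y ∧
      (x.1 = a.1.next ∧ y.1 = a.1.next.next ∨ x.1 = a.1.next.next ∧ y.1 = a.1.next) ∧
      totalLevel [signedArr y.1 s (rawTgt a).2,
        signedArr x.1 s (rawTgt (signedArr y.1 s (rawTgt a).2)).2] < totalLevel [x, y] := by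
  have hc := congrArg Prod.snd hxy
  rw [asrc_snd, atgt_snd] at hc
  obtain ⟨T, s, j, k⟩ := x
  obtain ⟨T', s', j', k'⟩ := y
  rcases h with ⟨h1, h2⟩ | ⟨h1, h2, h3⟩ | ⟨h1, h2, h3⟩ <;> dsimp only at h1 h2 <;> subst h1 h2 <;>
    simp only [rawTgt, Prod.mk.injEq] at hc
  · obtain ⟨rfl, rfl⟩ := hc
    refine ⟨(ArrT.C, s', j' - 1, k + 1), s', ?_⟩
    cases s <;> cases s' <;> simp [Signed, nonnegA, nonposA, bothHoriz, rawTgt, Triangle,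
      ValidArr, asrc, atgt, canon, ArrT.next, totalLevel, signedArr] at * <;> grind
  · obtain ⟨rfl, rfl⟩ := hc
    refine ⟨(ArrT.B, s, j, k - 1), s, ?_⟩
    cases s <;> cases s' <;> simp [Signed, nonnegA, nonposA, bothHoriz, rawTgt, Triangle,
      ValidArr, asrc, atgt, canon, ArrT.next, totalLevel, signedArr] at * <;> grind
  · obtain ⟨rfl, rfl⟩ := hc
    refine ⟨(ArrT.A, s', j' + 1, k), s', ?_⟩
    cases s <;> cases s' <;> simp [Signed, nonnegA, nonposA, bothHoriz, rawTgt, Triangle,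
      ValidArr, asrc, atgt, canon, ArrT.next, totalLevel, signedArr] at * <;> grind

/-! ### Cycles and their rotations -/

lemma endV_append (v : VT) (L M : List Arr) : endV v (L ++ M) = endV (endV v L) M := by
  induction L generalizing v with
  | nil => rfl
  | cons a L ih => exact ih _

lemma WFfrom.isVert {l : ℕ} {v : VT} {L : List Arr} (h : WFfrom l v L) : IsVert l v := by
  cases L with
  | nil => exact h
  | cons a L => exact h.2.1 ▸ h.1.isVert_asrc

lemma WFfrom_append {l : ℕ} {v : VT} {L M : List Arr} :
    WFfrom l v (L ++ M) ↔ WFfrom l v L ∧ WFfrom l (endV v L) M := by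
  induction L generalizing v with
  | nil => exact ⟨fun h => ⟨h.isVert, h⟩, fun h => h.2⟩
  | cons a L ih => simp only [List.cons_append, WFfrom, endV, ih, and_assoc]

/-- Oriented cycles of positive length. -/
def IsCycle (l : ℕ) (p : PathD) : Prop :=
  WFpath l p ∧ endV p.1 p.2 = p.1 ∧ p.2 ≠ []

lemma IsCycle.rotate {l : ℕ} {v : VT} {L M : List Arr} (h : IsCycle l (v, L ++ M)) :
    IsCycle l (endV v L, M ++ L) := by
  obtain ⟨h1, h2, h3⟩ := h
  simp only [WFpath, WFfrom_append, endV_append] at h1 h2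
  refine ⟨?_, ?_, ?_⟩
  · simp only [WFpath, WFfrom_append, h2]
    exact ⟨h1.2, h1.1⟩
  · simp only [endV_append, h2]
  · simpa [and_comm] using h3

lemma IsCycle.deltaP_sub_rotate_mem {l : ℕ} {v : VT} {L M : List Arr}
    (h : IsCycle l (v, L ++ M)) :
    deltaP (v, L ++ M) - deltaP (endV v L, M ++ L) ∈ Submodule.span ℂ (cycGens l) :=
  Submodule.subset_span ⟨(v, L ++ M), L.length, h.1, h.2.1, h.2.2, by simp [rotP]⟩

lemma endV_snd_eq {l : ℕ} {v : VT} {L : List Arr} (h : WFfrom l v L) :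
    (endV v L).2.1 + L.countP (fun a => a.1 = ArrT.A) =
        v.2.1 + L.countP (fun a => a.1 = ArrT.C) ∧
      (endV v L).2.2 + L.countP (fun a => a.1 = ArrT.C) =
        v.2.2 + L.countP (fun a => a.1 = ArrT.B) := by
  induction L generalizing v with
  | nil => simp [endV]
  | cons a L ih =>
    obtain ⟨ha, rfl, hL⟩ := h
    have := ih hL
    rw [atgt_snd] at this
    rw [asrc_snd]
    obtain ⟨_ | _ | _, s, j, k⟩ := a <;>
      simp only [endV, ValidArr, rawTgt, List.countP_cons] at ha this ⊢ <;> simp <;> omega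

lemma IsCycle.exists_type {l : ℕ} {p : PathD} (h : IsCycle l p) (T : ArrT) :
    ∃ a ∈ p.2, a.1 = T := by
  obtain ⟨v, L⟩ := p
  obtain ⟨h1, h2, h3⟩ := h
  have := endV_snd_eq h1
  rw [h2] at this
  obtain ⟨a, M, rfl⟩ := List.exists_cons_of_ne_nil h3
  have hpos : ∃ T', 0 < (a :: M).countP (fun b => b.1 = T') :=
    ⟨a.1, List.countP_pos_iff.2 ⟨a, by simp⟩⟩
  have hT : 0 < (a :: M).countP (fun b => b.1 = T) := by
    obtain ⟨T', h'⟩ := hpos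
    dsimp only at this
    cases T <;> cases T' <;> omega
  simpa using List.countP_pos_iff.1 hT

lemma exists_reducible_of_chain {l : ℕ} {x : Arr} {L : List Arr} {v : VT}
    (h : WFfrom l v (x :: L)) (hx : x.1 = ArrT.B ∨ x.1 = ArrT.C ∧ 1 ≤ x.2.2.1)
    (hA : ∃ a ∈ L, a.1 = ArrT.A) :
    ∃ L₁ y z L₂, x :: L = L₁ ++ y :: z :: L₂ ∧ Reducible y z := by
  induction L generalizing x v with
  | nil => simp at hA
  | cons y L ih =>
    by_cases hr : Reducible x y
    · exact ⟨[], x, y, L, rfl, hr⟩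
    obtain ⟨hvx, -, hL⟩ := h
    have hs := congrArg Prod.snd hL.2.1
    rw [asrc_snd, atgt_snd] at hs
    have hy : y.1 = ArrT.B ∨ y.1 = ArrT.C ∧ 1 ≤ y.2.2.1 := by
      obtain ⟨T, s, j, k⟩ := x
      obtain ⟨T', s', j', k'⟩ := y
      clear ih hA hL
      cases T <;> cases T' <;> simp [Reducible, ValidArr, rawTgt] at hx hr hs hvx ⊢ <;> omega
    have hA' : ∃ a ∈ L, a.1 = ArrT.A := by
      obtain ⟨a, ha, haA⟩ := hA
      rcases List.mem_cons.1 ha with rfl | ha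
      · simp [haA] at hy
      · exact ⟨a, ha, haA⟩
    obtain ⟨L₁, y', z, L₂, e, hred⟩ := ih hL hy hA'
    exact ⟨x :: L₁, y', z, L₂, by rw [e]; rfl, hred⟩

lemma totalLevel_append (L M : List Arr) : totalLevel (L ++ M) = totalLevel L + totalLevel M := by
  simp [totalLevel]

/-- Every cycle is cyclically equivalent to one starting with a reducible pair of arrows. -/
lemma IsCycle.exists_reducible {l : ℕ} {p : PathD} (h : IsCycle l p) :
    ∃ v x y L, IsCycle l (v, x :: y :: L) ∧ Reducible x y ∧
      totalLevel (x :: y :: L) = totalLevel p.2 ∧ (x :: y :: L).length = p.2.length ∧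
      deltaP p - deltaP (v, x :: y :: L) ∈ Submodule.span ℂ (cycGens l) := by
  obtain ⟨b, hb, hbB⟩ := h.exists_type ArrT.B
  obtain ⟨v, L⟩ := p
  obtain ⟨L₁, L₂, rfl⟩ := List.append_of_mem hb
  have h' := h.rotate
  have hA : ∃ a ∈ L₂ ++ L₁, a.1 = ArrT.A := by
    obtain ⟨a, ha, haA⟩ := h'.exists_type ArrT.A
    rcases List.mem_cons.1 ha with rfl | ha
    · simp [hbB] at haA
    · exact ⟨a, ha, haA⟩
  obtain ⟨M₁, x, y, M₂, e, hr⟩ := exists_reducible_of_chain h'.1 (Or.inl hbB) hA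
  have m₁ := h.deltaP_sub_rotate_mem
  have e' : b :: L₂ ++ L₁ = M₁ ++ x :: y :: M₂ := e
  have el : totalLevel (b :: L₂ ++ L₁) = totalLevel (M₁ ++ x :: y :: M₂) := by rw [e']
  have en : (b :: L₂ ++ L₁).length = (M₁ ++ x :: y :: M₂).length := by rw [e']
  rw [e'] at h' m₁
  refine ⟨_, x, y, M₂ ++ M₁, h'.rotate, hr, ?_, ?_, ?_⟩
  · rw [totalLevel_append, totalLevel_append] at el
    rw [← List.cons_append, ← List.cons_append, totalLevel_append, totalLevel_append]
    omega
  · simp only [List.length_append, List.length_cons] at en ⊢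
    omega
  · simpa using add_mem m₁ h'.deltaP_sub_rotate_mem

/-! ### Rewriting cycles modulo the Jacobian ideal -/

lemma lmul_rmul_deltaP {v : VT} {x y : Arr} (L : List Arr) :
    lmul (v, []) (rmul (deltaP (v, [x, y])) (atgt y, L)) = deltaP (v, x :: y :: L) := by
  funext ⟨w, M⟩
  simp only [lmul, rmul, deltaP, List.nil_prefix, and_true, endV, List.length_nil, List.drop_zero,
    Prod.mk.injEq]
  by_cases hw : w = v
  · subst hw
    simp only [if_true, true_and]
    by_cases hM : M = x :: y :: L
    · subst hM
      have : (x :: y :: L).take ((x :: y :: L).length - L.length) = [x, y] := by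
        rw [show (x :: y :: L).length - L.length = 2 by simp only [List.length_cons]; omega]
        rfl
      rw [this]
      simp only [endV, and_true, if_true]
      exact if_pos ⟨[x, y], rfl⟩
    · rw [if_neg hM]
      split_ifs with h1 h2
      · obtain ⟨⟨N, rfl⟩, -⟩ := h1
        rw [List.length_append, Nat.add_sub_cancel, List.take_left] at h2
        exact absurd (by rw [h2]; rfl) hM
      · rfl
      · rfl
  · simp [hw]

lemma lmul_rmul_sub (p q : PathD) (f g : CPA) :
    lmul p (rmul (f - g) q) = lmul p (rmul f q) - lmul p (rmul g q) := by
  funext r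
  simp only [lmul, rmul, Pi.sub_apply]
  split_ifs <;> simp

lemma lmul_rmul_smul (p q : PathD) (c : ℂ) (f : CPA) :
    lmul p (rmul (c • f) q) = c • lmul p (rmul f q) := by
  funext r
  simp only [lmul, rmul, Pi.smul_apply]
  split_ifs <;> simp

lemma lmul_rmul_zero (p q : PathD) : lmul p (rmul 0 q) = 0 := by
  simpa using lmul_rmul_smul p q 0 0

/-- Modulo the Jacobian ideal, a cycle starting with a reducible pair either vanishes or equals
a cycle of the same length and smaller total level. -/
lemma IsCycle.reduce {l : ℕ} {v : VT} {x y : Arr} {L : List Arr}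
    (h : IsCycle l (v, x :: y :: L)) (hr : Reducible x y) :
    deltaP (v, x :: y :: L) ∈ Submodule.span ℂ (jacGens l) ∨
      ∃ x' y', IsCycle l (v, x' :: y' :: L) ∧
        totalLevel (x' :: y' :: L) < totalLevel (x :: y :: L) ∧
        deltaP (v, x :: y :: L) - deltaP (v, x' :: y' :: L) ∈
          Submodule.span ℂ (jacGens l) := by
  obtain ⟨⟨hx, rfl, hy, hxy, hL⟩, hend, -⟩ := h
  obtain ⟨a, s, ha, ht, hsx, hsy, hT, hlt⟩ := hr.exists_triangle hx hy hxy
  obtain ⟨ε, hε, e⟩ := exists_cycDeriv_eq_smul ha ht hsx hsy hT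
  generalize signedArr y.1 s (rawTgt a).2 = x' at hlt e
  generalize signedArr x.1 s (rawTgt x').2 = y' at hlt e
  obtain ⟨hva, -, -, hsrc, -, -, hay⟩ := ht
  have hvert : IsVert l (asrc x) := hx.isVert_asrc
  have hgen : lmul (asrc x, []) (rmul (cycDeriv (Wpot l) a) (atgt y, L)) ∈
      Submodule.span ℂ (jacGens l) :=
    Submodule.subset_span ⟨a, (asrc x, []), (atgt y, L), hva, hvert, hL, hsrc, hay.symm, rfl⟩
  rw [e, lmul_rmul_smul, Submodule.smul_mem_iff _ hε, lmul_rmul_sub, lmul_rmul_deltaP] at hgen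
  unfold trianglePath at hgen
  split_ifs at hgen with h'
  · have hy' : atgt y' = atgt y := h'.2.2.2.2.2.2.symm.trans hay
    rw [← hy', hsrc, lmul_rmul_deltaP, ← hsrc] at hgen
    refine Or.inr ⟨x', y', ⟨?_, ?_, by simp⟩, ?_, hgen⟩
    · exact ⟨h'.2.1, h'.2.2.2.2.1.trans hsrc.symm, h'.2.2.1, h'.2.2.2.2.2.1, hy' ▸ hL⟩
    · simp only [endV, hy'] at hend ⊢
      exact hend
    · simp only [totalLevel, List.map_cons, List.sum_cons, List.map_nil, List.sum_nil] at hlt ⊢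
      omega
  · rw [lmul_rmul_zero, sub_zero] at hgen
    exact Or.inl hgen

lemma deltaP_apply_eq_zero {p q : PathD} (h : q.2.length ≠ p.2.length) : deltaP p q = 0 :=
  if_neg fun e => h (by rw [e])

/-- Every cycle is cyclically equivalent to an element of the Jacobian ideal, homogeneous of the
same length. -/
lemma IsCycle.exists_mem_span {l : ℕ} {p : PathD} (h : IsCycle l p) :
    ∃ f ∈ Submodule.span ℂ (jacGens l), (∀ q, q.2.length ≠ p.2.length → f q = 0) ∧
      deltaP p - f ∈ Submodule.span ℂ (cycGens l) := by
  induction hn : totalLevel p.2 using Nat.strong_induction_on generalizing p with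
  | _ n ih =>
  obtain ⟨v, x, y, L, hc, hr, hlev, hlen, hmem⟩ := h.exists_reducible
  rcases hc.reduce hr with hJ | ⟨x', y', hc', hlt, hJ⟩
  · exact ⟨_, hJ, fun q hq => deltaP_apply_eq_zero (hlen ▸ hq), hmem⟩
  · obtain ⟨f, hf, hf0, hf'⟩ := ih _ (by rw [← hn, ← hlev]; exact hlt) hc' rfl
    refine ⟨_, add_mem hJ hf, fun q hq => ?_, ?_⟩
    · rw [← hlen] at hq
      rw [Pi.add_apply, Pi.sub_apply, hf0 q hq, deltaP_apply_eq_zero hq, deltaP_apply_eq_zero hq]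
      simp
    · convert add_mem hmem hf' using 1
      abel

/-! ### Finiteness and assembly of infinite sums -/

lemma finite_labels (l : ℕ) : {v : VT | v.2.1 + v.2.2 ≤ l}.Finite :=
  (Set.finite_univ.prod ((Set.finite_Iic l).prod (Set.finite_Iic l))).subset fun v hv =>
    ⟨trivial, by simp at hv ⊢; omega, by simp at hv ⊢; omega⟩

lemma finite_validArr (l : ℕ) : {a : Arr | ValidArr l a}.Finite :=
  (Set.finite_univ.prod (finite_labels l)).subset fun a ha =>
    ⟨trivial, by obtain ⟨_ | _ | _, s, j, k⟩ := a <;> simp [ValidArr] at ha ⊢ <;> omega⟩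

lemma finite_paths_length_le (l n : ℕ) : {p : PathD | WFpath l p ∧ p.2.length ≤ n}.Finite := by
  induction n with
  | zero =>
    refine ((finite_labels l).image fun v => (v, [])).subset ?_
    rintro ⟨v, L⟩ ⟨h, hL⟩
    obtain rfl := List.eq_nil_of_length_eq_zero (Nat.le_zero.1 hL)
    exact ⟨v, h.2.2, rfl⟩
  | succ n ih =>
    refine (((finite_labels l).image fun v => (v, [])).union
      (Set.Finite.image2 (fun a (p : PathD) => (asrc a, a :: p.2)) (finite_validArr l) ih)).subset ?_
    rintro ⟨v, _ | ⟨a, L⟩⟩ ⟨h, hL⟩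
    · exact Or.inl ⟨v, h.2.2, rfl⟩
    · obtain ⟨ha, rfl, hL'⟩ := h
      exact Or.inr ⟨a, ha, (atgt a, L), ⟨hL', by simpa using hL⟩, rfl⟩

/-- the ice quiver with potential `(Diamond_l, W_l)` is rigid: every
potential on `Diamond_l` is cyclically equivalent to an element of the (closed) Jacobian
ideal `∂W_l`. -/
theorem statement8 (l : ℕ) (hl : 1 ≤ l) (U : CPA) (hU : IsPotential l U) :
    ∃ h ∈ closSpan (jacGens l), U - h ∈ closSpan (cycGens l) := by
  have hex : ∀ p : PathD, ∃ f ∈ Submodule.span ℂ (jacGens l),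
      (∀ q, q.2.length ≠ p.2.length → f q = 0) ∧
      (U p ≠ 0 → deltaP p - f ∈ Submodule.span ℂ (cycGens l)) := by
    intro p
    by_cases hp : U p = 0
    · exact ⟨0, zero_mem _, fun _ _ => rfl, fun h => absurd hp h⟩
    · obtain ⟨f, hf, hf0, hf'⟩ := IsCycle.exists_mem_span (hU p hp)
      exact ⟨f, hf, hf0, fun _ => hf'⟩
  choose f hf hf0 hf' using hex
  let G : ℕ → Finset PathD := fun n => (finite_paths_length_le l n).toFinset
  have hG : ∀ n p, p ∈ G n ↔ WFpath l p ∧ p.2.length ≤ n := fun n p => by simp [G]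
  have hsum : ∀ n (q : PathD), q.2.length ≤ n →
      ∑ p ∈ G q.2.length, U p * f p q = ∑ p ∈ G n, U p * f p q := by
    intro n q hq
    refine Finset.sum_subset (fun p hp => ?_) fun p hp hp' => ?_
    · rw [hG] at hp ⊢
      exact ⟨hp.1, hp.2.trans hq⟩
    · rw [hG] at hp hp'
      rw [hf0 p q fun e => hp' ⟨hp.1, e.ge⟩, mul_zero]
  refine ⟨fun q => ∑ p ∈ G q.2.length, U p * f p q, fun n => ?_, fun n => ?_⟩
  · refine ⟨∑ p ∈ G n, U p • f p, sum_mem fun p _ => Submodule.smul_mem _ _ (hf p), ?_⟩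
    intro q hq
    simp only [hsum n q hq, Finset.sum_apply, Pi.smul_apply, smul_eq_mul]
  · refine ⟨∑ p ∈ G n, U p • (deltaP p - f p), sum_mem fun p _ => ?_, ?_⟩
    · by_cases hp : U p = 0
      · rw [hp, zero_smul]
        exact zero_mem _
      · exact Submodule.smul_mem _ _ (hf' p hp)
    · intro q hq
      have hUq : ∑ p ∈ G n, U p * deltaP p q = U q := by
        simp only [deltaP, mul_ite, mul_one, mul_zero, Finset.sum_ite_eq]
        split_ifs with h
        · rfl
        · by_contra h0
          exact h ((hG n q).2 ⟨(hU q fun e => h0 e.symm).1, hq⟩)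
      simp only [Pi.sub_apply, hsum n q hq, Finset.sum_apply, Pi.smul_apply, smul_eq_mul, mul_sub,
        Finset.sum_sub_distrib, hUq]
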